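/- arXiv:1710.09318 — 7 statements merged into one kernel-verified Lean document; each statement's English description precedes it below -/
import Mathlib

section
/- Let r^k and r^j be two feasible rate demand vectors in the feasible rate region X with r^j ≥ r^k componentwise, and let ρ^k, ρ^j ∈ ℝ^M satisfy ρ^k ≥ 0, Γ_{r^k}(ρ^k) = ρ^k and ρ^j ≥ 0, Γ_{r^j}(ρ^j) = ρ^j. Then ρ^j ≥ ρ^k componentwise. -/
open Finset

/-- SINR of the link from base station `i` to test point `j`, given load vector `ρ`. -/
noncomputable def gamma (M N : ℕ) (p : Fin M → ℝ) (G : Fin M → Fin N → ℝ) (s2 : ℝ)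
    (ρ : Fin M → ℝ) (i : Fin M) (j : Fin N) : ℝ :=
  p i * G i j / ((∑ k ∈ Finset.univ.erase i, p k * G k j * ρ k) + s2)

/-- The load mapping `q(ρ, r)`; `serv j` is the (unique) base station serving test point `j`,
so that `N(i) = {j | serv j = i}`. -/
noncomputable def loadMap (M N : ℕ) (p : Fin M → ℝ) (G : Fin M → Fin N → ℝ) (s2 c : ℝ)
    (serv : Fin N → Fin M) (ρ : Fin M → ℝ) (r : Fin N → ℝ) : Fin M → ℝ :=
  fun i => (1 / c) * ∑ j ∈ Finset.univ.filter (fun j => serv j = i),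
    r j / Real.log (1 + gamma M N p G s2 ρ i j)

/-- A rate vector `r > 0` is feasible if the load mapping `Γ_r` has a fixed point `ρ*`
with `0 ≤ ρ* ≤ 1` componentwise. -/
def Feasible (M N : ℕ) (p : Fin M → ℝ) (G : Fin M → Fin N → ℝ) (s2 c : ℝ)
    (serv : Fin N → Fin M) (r : Fin N → ℝ) : Prop :=
  ∃ ρ : Fin M → ℝ, (∀ i, 0 ≤ ρ i) ∧ (∀ i, ρ i ≤ 1) ∧ loadMap M N p G s2 c serv ρ r = ρ

/-- The feasible rate region `X`. -/
def FeasRegion (M N : ℕ) (p : Fin M → ℝ) (G : Fin M → Fin N → ℝ) (s2 c : ℝ)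
    (serv : Fin N → Fin M) (rmin : Fin N → ℝ) : Set (Fin N → ℝ) :=
  {r | (∀ j, 0 < r j) ∧ (∀ j, rmin j ≤ r j) ∧ Feasible M N p G s2 c serv r}

theorem Real.log_one_add_div_lt_mul_log_one_add_div {S s t I J : ℝ} (hS : 0 < S) (hs : 0 < s)
    (ht : 1 < t) (hI : 0 ≤ I) (hJ : 0 ≤ J) (hIJ : I ≤ t * J) :
    Real.log (1 + S / (J + s)) < t * Real.log (1 + S / (I + s)) := by
  have ht0 : 0 < t := one_pos.trans ht
  have hJs : 0 < J + s := by positivity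
  have hx : 0 < S / (t * (J + s)) := by positivity
  have bernoulli : 1 + S / (J + s) ≤ (1 + S / (t * (J + s))) ^ t := by
    have h := one_add_mul_self_le_rpow_one_add (s := S / (t * (J + s))) (by linarith) ht.le
    rwa [← mul_div_assoc, mul_div_mul_left S (J + s) ht0.ne'] at h
  calc Real.log (1 + S / (J + s)) ≤ Real.log ((1 + S / (t * (J + s))) ^ t) :=
        Real.log_le_log (by positivity) bernoulli
    _ = t * Real.log (1 + S / (t * (J + s))) := Real.log_rpow (by positivity) t
    _ < t * Real.log (1 + S / (I + s)) := by
        gcongr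
        nlinarith

/-- If `ρ ≤ t ρ'` with `t > 1` and `r ≤ r'`, the load of a base station that serves some
test point satisfies `q_i(ρ, r) < t q_i(ρ', r')`. -/
theorem loadMap_lt_mul_loadMap {M N : ℕ} {p : Fin M → ℝ} (hp : ∀ i, 0 < p i)
    {G : Fin M → Fin N → ℝ} (hG : ∀ k j, 0 ≤ G k j) {s2 : ℝ} (hs2 : 0 < s2) {c : ℝ} (hc : 0 < c)
    {serv : Fin N → Fin M} (hserv : ∀ j, 0 < G (serv j) j) {r r' : Fin N → ℝ}
    (hr : ∀ j, 0 < r j) (hrr' : ∀ j, r j ≤ r' j) {ρ ρ' : Fin M → ℝ}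
    (hρ : ∀ i, 0 ≤ ρ i) (hρ' : ∀ i, 0 ≤ ρ' i) {t : ℝ} (ht : 1 < t)
    (hle : ∀ i, ρ i ≤ t * ρ' i) {i : Fin M} (hi : ∃ j, serv j = i) :
    loadMap M N p G s2 c serv ρ r i < t * loadMap M N p G s2 c serv ρ' r' i := by
  have interference_nonneg : ∀ {τ : Fin M → ℝ}, (∀ k, 0 ≤ τ k) → ∀ j,
      0 ≤ ∑ k ∈ univ.erase i, p k * G k j * τ k := fun hτ j =>
    sum_nonneg fun k _ => mul_nonneg (mul_nonneg (hp k).le (hG k j)) (hτ k)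
  obtain ⟨j₀, hj₀⟩ := hi
  rw [loadMap, loadMap, mul_left_comm]
  refine mul_lt_mul_of_pos_left ?_ (one_div_pos.2 hc)
  rw [mul_sum]
  refine sum_lt_sum_of_nonempty ⟨j₀, by simpa⟩ fun j hj => ?_
  obtain rfl : serv j = i := by simpa using hj
  have hS : 0 < p (serv j) * G (serv j) j := mul_pos (hp _) (hserv j)
  have log_pos : ∀ {τ : Fin M → ℝ}, (∀ k, 0 ≤ τ k) →
      0 < Real.log (1 + gamma M N p G s2 τ (serv j) j) := fun hτ =>
    Real.log_pos (lt_add_of_pos_right 1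
      (div_pos hS (add_pos_of_nonneg_of_pos (interference_nonneg hτ j) hs2)))
  have hlog : Real.log (1 + gamma M N p G s2 ρ' (serv j) j) <
      t * Real.log (1 + gamma M N p G s2 ρ (serv j) j) := by
    refine Real.log_one_add_div_lt_mul_log_one_add_div hS hs2 ht (interference_nonneg hρ j)
      (interference_nonneg hρ' j) ?_
    rw [mul_sum]
    refine sum_le_sum fun k _ => ?_
    rw [mul_left_comm]
    exact mul_le_mul_of_nonneg_left (hle k) (mul_nonneg (hp k).le (hG k j))
  have hL := log_pos hρ
  have hL' := log_pos hρ'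
  rw [← mul_div_assoc, div_lt_div_iff₀ hL hL']
  calc r j * Real.log (1 + gamma M N p G s2 ρ' (serv j) j)
      < r j * (t * Real.log (1 + gamma M N p G s2 ρ (serv j) j)) :=
        mul_lt_mul_of_pos_left hlog (hr j)
    _ ≤ r' j * (t * Real.log (1 + gamma M N p G s2 ρ (serv j) j)) := by
        gcongr
        exact hrr' j
    _ = t * r' j * Real.log (1 + gamma M N p G s2 ρ (serv j) j) := by ring

theorem loadMap_eq_zero {M N : ℕ} {p : Fin M → ℝ} {G : Fin M → Fin N → ℝ} {s2 c : ℝ}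
    {serv : Fin N → Fin M} {ρ : Fin M → ℝ} {r : Fin N → ℝ} {i : Fin M}
    (hi : ¬∃ j, serv j = i) : loadMap M N p G s2 c serv ρ r i = 0 := by
  rw [loadMap, filter_false_of_mem fun j _ h => hi ⟨j, h⟩, sum_empty, mul_zero]

theorem loadMap_pos {M N : ℕ} {p : Fin M → ℝ} (hp : ∀ i, 0 < p i)
    {G : Fin M → Fin N → ℝ} (hG : ∀ k j, 0 ≤ G k j) {s2 : ℝ} (hs2 : 0 < s2) {c : ℝ} (hc : 0 < c)
    {serv : Fin N → Fin M} (hserv : ∀ j, 0 < G (serv j) j) {r : Fin N → ℝ}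
    (hr : ∀ j, 0 < r j) {ρ : Fin M → ℝ} (hρ : ∀ i, 0 ≤ ρ i) {i : Fin M}
    (hi : ∃ j, serv j = i) : 0 < loadMap M N p G s2 c serv ρ r i := by
  have h := loadMap_lt_mul_loadMap hp hG hs2 hc hserv hr (fun _ => le_rfl) hρ hρ one_lt_two
    (fun k => by linarith [hρ k]) hi
  linarith

/-- Monotonicity of the fixed point in the rate demand: if `r^k ≤ r^j`
are both in the feasible rate region and `ρ^k, ρ^j` are corresponding nonnegative fixed
points, then `ρ^k ≤ ρ^j` componentwise. -/
theorem fixedPoint_monotone_in_rate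
    {M N : ℕ} (hM : 0 < M) (hN : 0 < N)
    (p : Fin M → ℝ) (hp : ∀ i, 0 < p i)
    (G : Fin M → Fin N → ℝ) (hG : ∀ k j, 0 ≤ G k j)
    (s2 : ℝ) (hs2 : 0 < s2) (c : ℝ) (hc : 0 < c)
    (serv : Fin N → Fin M) (hserv : ∀ j, 0 < G (serv j) j)
    (rmin : Fin N → ℝ) (hrmin : ∀ j, 0 < rmin j)
    (rk rj : Fin N → ℝ)
    (hrk : rk ∈ FeasRegion M N p G s2 c serv rmin)
    (hrj : rj ∈ FeasRegion M N p G s2 c serv rmin)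
    (hle : ∀ j, rk j ≤ rj j)
    (ρk ρj : Fin M → ℝ)
    (hρk0 : ∀ i, 0 ≤ ρk i) (hρkfix : loadMap M N p G s2 c serv ρk rk = ρk)
    (hρj0 : ∀ i, 0 ≤ ρj i) (hρjfix : loadMap M N p G s2 c serv ρj rj = ρj) :
    ∀ i, ρk i ≤ ρj i := by
  by_contra! h
  obtain ⟨i₀, hi₀⟩ := h
  have ρj_pos : ∀ {i}, (∃ j, serv j = i) → 0 < ρj i := fun {i} hi =>
    hρjfix ▸ loadMap_pos hp hG hs2 hc hserv hrj.1 hρj0 hi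
  have ρk_zero : ∀ {i}, (¬∃ j, serv j = i) → ρk i = 0 := fun {i} hi =>
    hρkfix ▸ loadMap_eq_zero hi
  obtain ⟨m, -, hm⟩ := exists_max_image univ (fun i => ρk i / ρj i) ⟨i₀, mem_univ i₀⟩
  have hi₀serves : ∃ j, serv j = i₀ := by
    by_contra hi
    linarith [ρk_zero hi, hρj0 i₀]
  have ht : 1 < ρk m / ρj m :=
    ((one_lt_div (ρj_pos hi₀serves)).2 hi₀).trans_le (hm i₀ (mem_univ i₀))
  have hmserves : ∃ j, serv j = m := by
    by_contra hi
    rw [ρk_zero hi, zero_div] at ht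
    linarith
  have hscale : ∀ i, ρk i ≤ ρk m / ρj m * ρj i := fun i => by
    by_cases hi : ∃ j, serv j = i
    · exact (div_le_iff₀ (ρj_pos hi)).1 (hm i (mem_univ i))
    · rw [ρk_zero hi]
      exact mul_nonneg (one_pos.trans ht).le (hρj0 i)
  have hlt := loadMap_lt_mul_loadMap hp hG hs2 hc hserv hrk.1 hle hρk0 hρj0 ht hscale hmserves
  rw [hρkfix, hρjfix, div_mul_cancel₀ _ (ρj_pos hmserves).ne'] at hlt
  exact hlt.false
end

section
/- The feasible rate region X is a bounded subset of ℝ^N. -/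
open Finset

section

variable {M N : ℕ} {p : Fin M → ℝ} {G : Fin M → Fin N → ℝ} {s2 c : ℝ}
  {serv : Fin N → Fin M} {ρ : Fin M → ℝ} {r : Fin N → ℝ}

lemma interference_nonneg (hp : ∀ i, 0 < p i) (hG : ∀ k j, 0 ≤ G k j) (hρ : ∀ i, 0 ≤ ρ i)
    (i : Fin M) (j : Fin N) : 0 ≤ ∑ k ∈ Finset.univ.erase i, p k * G k j * ρ k :=
  Finset.sum_nonneg fun k _ => mul_nonneg (mul_nonneg (hp k).le (hG k j)) (hρ k)

lemma gamma_nonneg (hp : ∀ i, 0 < p i) (hG : ∀ k j, 0 ≤ G k j) (hs2 : 0 < s2)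
    (hρ : ∀ i, 0 ≤ ρ i) (i : Fin M) (j : Fin N) : 0 ≤ gamma M N p G s2 ρ i j :=
  div_nonneg (mul_nonneg (hp i).le (hG i j))
    (add_nonneg (interference_nonneg hp hG hρ i j) hs2.le)

lemma gamma_pos (hp : ∀ i, 0 < p i) (hG : ∀ k j, 0 ≤ G k j) (hs2 : 0 < s2)
    (hρ : ∀ i, 0 ≤ ρ i) {i : Fin M} {j : Fin N} (hij : 0 < G i j) :
    0 < gamma M N p G s2 ρ i j :=
  div_pos (mul_pos (hp i) hij)
    (add_pos_of_nonneg_of_pos (interference_nonneg hp hG hρ i j) hs2)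

/-- The SINR is at most the signal-to-noise ratio without interference. -/
lemma gamma_le_snr (hp : ∀ i, 0 < p i) (hG : ∀ k j, 0 ≤ G k j) (hs2 : 0 < s2)
    (hρ : ∀ i, 0 ≤ ρ i) (i : Fin M) (j : Fin N) :
    gamma M N p G s2 ρ i j ≤ p i * G i j / s2 :=
  div_le_div_of_nonneg_left (mul_nonneg (hp i).le (hG i j)) hs2
    (le_add_of_nonneg_left (interference_nonneg hp hG hρ i j))

lemma rate_le_of_loadMap_le_one (hp : ∀ i, 0 < p i) (hG : ∀ k j, 0 ≤ G k j) (hs2 : 0 < s2)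
    (hc : 0 < c) (hserv : ∀ j, 0 < G (serv j) j) (hρ : ∀ i, 0 ≤ ρ i) (hr : ∀ j, 0 ≤ r j)
    (hload : ∀ i, loadMap M N p G s2 c serv ρ r i ≤ 1) (j : Fin N) :
    r j ≤ c * (p (serv j) * G (serv j) j / s2) := by
  have hγ := gamma_pos hp hG hs2 hρ (hserv j)
  have hlog : 0 < Real.log (1 + gamma M N p G s2 ρ (serv j) j) :=
    Real.log_pos (by linarith)
  have hsum : r j / Real.log (1 + gamma M N p G s2 ρ (serv j) j) ≤
      ∑ l ∈ Finset.univ.filter (fun l => serv l = serv j),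
        r l / Real.log (1 + gamma M N p G s2 ρ (serv j) l) :=
    Finset.single_le_sum
      (f := fun l => r l / Real.log (1 + gamma M N p G s2 ρ (serv j) l))
      (fun l _ => div_nonneg (hr l)
        (Real.log_nonneg (le_add_of_nonneg_right (gamma_nonneg hp hG hs2 hρ _ l))))
      (by simp)
  have hle := hload (serv j)
  rw [loadMap, one_div, inv_mul_le_iff₀ hc, mul_one] at hle
  calc r j ≤ c * Real.log (1 + gamma M N p G s2 ρ (serv j) j) :=
        (div_le_iff₀ hlog).1 (hsum.trans hle)
    _ ≤ c * gamma M N p G s2 ρ (serv j) j := by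
        have := Real.log_le_sub_one_of_pos (x := 1 + gamma M N p G s2 ρ (serv j) j)
          (by linarith)
        gcongr
        linarith
    _ ≤ c * (p (serv j) * G (serv j) j / s2) := by
        gcongr
        exact gamma_le_snr hp hG hs2 hρ _ j

end

/-- The feasible rate region `X` is bounded. -/
theorem feasRegion_bounded
    {M N : ℕ} (hM : 0 < M) (hN : 0 < N)
    (p : Fin M → ℝ) (hp : ∀ i, 0 < p i)
    (G : Fin M → Fin N → ℝ) (hG : ∀ k j, 0 ≤ G k j)
    (s2 : ℝ) (hs2 : 0 < s2) (c : ℝ) (hc : 0 < c)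
    (serv : Fin N → Fin M) (hserv : ∀ j, 0 < G (serv j) j)
    (rmin : Fin N → ℝ) (hrmin : ∀ j, 0 < rmin j)
    (hXne : (FeasRegion M N p G s2 c serv rmin).Nonempty) :
    Bornology.IsBounded (FeasRegion M N p G s2 c serv rmin) := by
  refine (Metric.isBounded_Icc (0 : Fin N → ℝ)
    fun j => c * (p (serv j) * G (serv j) j / s2)).subset ?_
  rintro r ⟨hr, -, ρ, hρ0, hρ1, hfix⟩
  exact ⟨fun j => (hr j).le, rate_le_of_loadMap_le_one hp hG hs2 hc hserv hρ0
    (fun j => (hr j).le) fun i => (congrFun hfix i).trans_le (hρ1 i)⟩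
end

section
/- Let Γ be a positive concave mapping on ℝ_+^M and suppose (ρ*, λ*) ∈ ℝ_+^M × ℝ_+ satisfies Γ(ρ*) = λ* ρ* and ‖ρ*‖_∞ = 1. Then Γ has a fixed point ρ' with 0 ≤ ρ' ≤ 1 componentwise if and only if 0 < λ* ≤ 1; moreover, when λ* ≤ 1 a fixed point ρ' with ρ' ≤ ρ* componentwise exists. -/
/-- A nonnegative concave function on the nonnegative orthant is monotone there. -/
theorem ConcaveOn.monotoneOn_orthant {ι : Type*} {f : (ι → ℝ) → ℝ}
    (hf : ConcaveOn ℝ {x : ι → ℝ | ∀ k, 0 ≤ x k} f)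
    (hpos : ∀ x : ι → ℝ, (∀ k, 0 ≤ x k) → 0 ≤ f x) :
    MonotoneOn f {x : ι → ℝ | ∀ k, 0 ≤ x k} := by
  intro x hx y hy hxy
  have key : ∀ s : ℝ, 0 < s → s ≤ 1 → (1 - s) * f x ≤ f y := by
    intro s hs hs1
    have hz : ∀ k, 0 ≤ (x + s⁻¹ • (y - x)) k := fun k => by
      have h1 : 0 ≤ s⁻¹ * (y k - x k) := mul_nonneg (inv_nonneg.2 hs.le) (sub_nonneg.2 (hxy k))
      have h2 := hx k
      simp only [Pi.add_apply, Pi.smul_apply, Pi.sub_apply, smul_eq_mul]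
      linarith
    have h := hf.2 hx hz (sub_nonneg.2 hs1) hs.le (sub_add_cancel 1 s)
    have hy' : (1 - s) • x + s • (x + s⁻¹ • (y - x)) = y := by
      rw [smul_add, smul_smul, mul_inv_cancel₀ hs.ne']
      module
    rw [hy', smul_eq_mul, smul_eq_mul] at h
    have := mul_nonneg hs.le (hpos _ hz)
    linarith
  by_contra! hlt
  have hfy := hpos y hy
  have hfx : 0 < f x := hfy.trans_lt hlt
  have h := key ((f x - f y) / (2 * f x)) (div_pos (by linarith) (by linarith))
    ((div_le_one (by linarith)).2 (by linarith))
  have h2 : (f x - f y) / (2 * f x) * f x = (f x - f y) / 2 := by field_simp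
  linarith

/-- A nonnegative concave function on the nonnegative orthant is subhomogeneous there. -/
theorem ConcaveOn.mul_le_map_smul_orthant {ι : Type*} {f : (ι → ℝ) → ℝ}
    (hf : ConcaveOn ℝ {x : ι → ℝ | ∀ k, 0 ≤ x k} f) (h0 : 0 ≤ f 0)
    {x : ι → ℝ} (hx : ∀ k, 0 ≤ x k) {c : ℝ} (hc0 : 0 ≤ c) (hc1 : c ≤ 1) :
    c * f x ≤ f (c • x) := by
  have h := hf.2 (x := 0) (y := x) (fun _ => le_rfl) hx (sub_nonneg.2 hc1) hc0
    (sub_add_cancel 1 c)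
  rw [smul_zero, zero_add, smul_eq_mul, smul_eq_mul] at h
  have := mul_nonneg (sub_nonneg.2 hc1) h0
  linarith

/-- Knaster–Tarski for order intervals of `ι → ℝ`. -/
theorem exists_fixedPoint_of_monotoneOn_Icc {ι : Type*} {F : (ι → ℝ) → ι → ℝ} {a b : ι → ℝ}
    (hab : a ≤ b) (hF : MonotoneOn F (Set.Icc a b)) (ha : a ≤ F a) (hb : F b ≤ b) :
    ∃ x ∈ Set.Icc a b, F x = x := by
  let S : Set (ι → ℝ) := {x | x ∈ Set.Icc a b ∧ x ≤ F x}
  let u : ι → ℝ := fun i => sSup ((fun x => x i) '' S)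
  have haS : a ∈ S := ⟨⟨le_rfl, hab⟩, ha⟩
  have hle : ∀ x ∈ S, x ≤ u := fun x hx i =>
    le_csSup ⟨b i, by rintro _ ⟨y, hy, rfl⟩; exact hy.1.2 i⟩ ⟨x, hx, rfl⟩
  have hlub : ∀ v : ι → ℝ, (∀ x ∈ S, x ≤ v) → u ≤ v := fun v hv i =>
    csSup_le ⟨_, a, haS, rfl⟩ (by rintro _ ⟨y, hy, rfl⟩; exact hv y hy i)
  have hu : u ∈ Set.Icc a b := ⟨hle a haS, hlub b fun x hx => hx.1.2⟩
  have huF : u ≤ F u := hlub _ fun x hx => hx.2.trans (hF hx.1 hu (hle x hx))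
  have hFu : F u ∈ Set.Icc a b :=
    ⟨hu.1.trans huF, (hF hu ⟨hab, le_rfl⟩ hu.2).trans hb⟩
  exact ⟨u, hu, le_antisymm (hle _ ⟨hFu, hF hu hFu huF⟩) huF⟩

/-- Let `Γ` be a positive concave mapping on `ℝ₊^M` and suppose
`(ρ*, λ*)` satisfies `Γ(ρ*) = λ* ρ*` with `ρ* ≥ 0`, `λ* ≥ 0` and `‖ρ*‖_∞ = 1`.
Then `Γ` has a fixed point `ρ'` with `0 ≤ ρ' ≤ 1` iff `0 < λ* ≤ 1`; moreover, when
`λ* ≤ 1` a fixed point `ρ'` with `ρ' ≤ ρ*` componentwise exists.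
(The norm on `Fin M → ℝ` is the sup norm `‖·‖_∞`.) -/
theorem positiveConcave_fixedPoint_iff_eigenvalue
    {M : ℕ} (hM : 0 < M)
    (Γ : (Fin M → ℝ) → (Fin M → ℝ))
    (hΓpos : ∀ ρ : Fin M → ℝ, (∀ i, 0 ≤ ρ i) → ∀ i, 0 < Γ ρ i)
    (hΓconc : ∀ i : Fin M,
      ConcaveOn ℝ {ρ : Fin M → ℝ | ∀ k, 0 ≤ ρ k} (fun ρ => Γ ρ i))
    (ρStar : Fin M → ℝ) (lamStar : ℝ)
    (hρStar0 : ∀ i, 0 ≤ ρStar i) (hlamStar0 : 0 ≤ lamStar)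
    (heig : Γ ρStar = fun i => lamStar * ρStar i)
    (hnorm : ‖ρStar‖ = 1) :
    ((∃ ρ' : Fin M → ℝ, (∀ i, 0 ≤ ρ' i) ∧ (∀ i, ρ' i ≤ 1) ∧ Γ ρ' = ρ') ↔
      (0 < lamStar ∧ lamStar ≤ 1)) ∧
    (lamStar ≤ 1 →
      ∃ ρ' : Fin M → ℝ, (∀ i, 0 ≤ ρ' i) ∧ (∀ i, ρ' i ≤ 1) ∧ (∀ i, ρ' i ≤ ρStar i) ∧
        Γ ρ' = ρ') := by
  have hmono : MonotoneOn Γ {ρ : Fin M → ℝ | ∀ k, 0 ≤ ρ k} := fun x hx y hy hxy i =>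
    (hΓconc i).monotoneOn_orthant (fun ρ hρ => (hΓpos ρ hρ i).le) hx hy hxy
  have heig' : ∀ i, Γ ρStar i = lamStar * ρStar i := fun i => congrFun heig i
  have hmul : ∀ i, 0 < lamStar * ρStar i := fun i => heig' i ▸ hΓpos ρStar hρStar0 i
  have hlam : 0 < lamStar := pos_of_mul_pos_left (hmul ⟨0, hM⟩) (hρStar0 _)
  have hρpos : ∀ i, 0 < ρStar i := fun i => pos_of_mul_pos_right (hmul i) hlamStar0
  have hρ1 : ∀ i, ρStar i ≤ 1 := fun i =>
    (le_abs_self _).trans (hnorm ▸ norm_le_pi_norm ρStar i)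
  have hex : lamStar ≤ 1 →
      ∃ ρ' : Fin M → ℝ, (∀ i, 0 ≤ ρ' i) ∧ (∀ i, ρ' i ≤ 1) ∧ (∀ i, ρ' i ≤ ρStar i) ∧
        Γ ρ' = ρ' := by
    intro hle
    obtain ⟨x, hx, hfix⟩ := exists_fixedPoint_of_monotoneOn_Icc (F := Γ) (a := 0) (b := ρStar)
      hρStar0 (hmono.mono fun x hx => hx.1) (fun i => (hΓpos 0 (fun _ => le_rfl) i).le)
      (fun i => heig' i ▸ mul_le_of_le_one_left (hρStar0 i) hle)
    exact ⟨x, hx.1, fun i => (hx.2 i).trans (hρ1 i), hx.2, hfix⟩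
  refine ⟨⟨?_, fun h => ?_⟩, hex⟩
  · rintro ⟨x, hx0, hx1, hfix⟩
    refine ⟨hlam, ?_⟩
    have : Nonempty (Fin M) := ⟨⟨0, hM⟩⟩
    obtain ⟨k, hk⟩ : ∃ k, 1 ≤ ρStar k := by
      by_contra! hlt
      exact hnorm.not_lt ((pi_norm_lt_iff one_pos).2 fun i => by
        rw [Real.norm_of_nonneg (hρStar0 i)]; exact hlt i)
    obtain ⟨j, hj⟩ := Finite.exists_min fun i => x i / ρStar i
    have hxj : 0 < x j := hfix ▸ hΓpos x hx0 j
    set c := x j / ρStar j with hc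
    have hc0 : 0 < c := div_pos hxj (hρpos j)
    have hc1 : c ≤ 1 := (hj k).trans ((div_le_one (hρpos k)).2 ((hx1 k).trans hk))
    have hcx : c • ρStar ≤ x := fun i => (le_div_iff₀ (hρpos i)).1 (hj i)
    have h1 : Γ (c • ρStar) j ≤ x j :=
      (hmono (fun i => mul_nonneg hc0.le (hρStar0 i)) hx0 hcx j).trans_eq (congrFun hfix j)
    have h2 := (hΓconc j).mul_le_map_smul_orthant (hΓpos 0 (fun _ => le_rfl) j).le hρStar0
      hc0.le hc1
    have hcj : c * ρStar j = x j := div_mul_cancel₀ _ (hρpos j).ne'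
    have h3 : lamStar * x j ≤ 1 * x j := by
      rw [← hcj, one_mul, mul_left_comm, ← heig' j, hcj]
      exact h2.trans h1
    exact le_of_mul_le_mul_right h3 hxj
  · obtain ⟨x, h0, h1, -, hfix⟩ := hex h.2
    exact ⟨x, h0, h1, hfix⟩
end

section
/- The set of achievable cell-load vectors Y = {ρ ∈ ℝ^M : 0 ≤ ρ ≤ 1 componentwise and there exists r ∈ X with Γ_r(ρ) = ρ} is a compact subset of ℝ^M. -/
open Finset

section

variable {M N : ℕ} {p : Fin M → ℝ} {G : Fin M → Fin N → ℝ} {s2 c : ℝ} {serv : Fin N → Fin M}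
  {ρ : Fin M → ℝ}

lemma interference_add_noise_pos (hp : ∀ i, 0 < p i) (hG : ∀ k j, 0 ≤ G k j) (hs2 : 0 < s2)
    (hρ : ∀ i, 0 ≤ ρ i) (i : Fin M) (j : Fin N) :
    0 < (∑ k ∈ Finset.univ.erase i, p k * G k j * ρ k) + s2 :=
  add_pos_of_nonneg_of_pos
    (Finset.sum_nonneg fun k _ => mul_nonneg (mul_nonneg (hp k).le (hG k j)) (hρ k)) hs2

lemma gamma_serv_pos (hp : ∀ i, 0 < p i) (hG : ∀ k j, 0 ≤ G k j) (hs2 : 0 < s2)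
    (hserv : ∀ j, 0 < G (serv j) j) (hρ : ∀ i, 0 ≤ ρ i) (j : Fin N) :
    0 < gamma M N p G s2 ρ (serv j) j :=
  div_pos (mul_pos (hp _) (hserv j)) (interference_add_noise_pos hp hG hs2 hρ _ j)

lemma log_one_add_gamma_serv_pos (hp : ∀ i, 0 < p i) (hG : ∀ k j, 0 ≤ G k j) (hs2 : 0 < s2)
    (hserv : ∀ j, 0 < G (serv j) j) (hρ : ∀ i, 0 ≤ ρ i) (j : Fin N) :
    0 < Real.log (1 + gamma M N p G s2 ρ (serv j) j) :=
  Real.log_pos (by linarith [gamma_serv_pos hp hG hs2 hserv hρ j])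

lemma loadMap_mono_rate (hp : ∀ i, 0 < p i) (hG : ∀ k j, 0 ≤ G k j) (hs2 : 0 < s2) (hc : 0 < c)
    (hserv : ∀ j, 0 < G (serv j) j) (hρ : ∀ i, 0 ≤ ρ i) {r r' : Fin N → ℝ}
    (h : ∀ j, r j ≤ r' j) (i : Fin M) :
    loadMap M N p G s2 c serv ρ r i ≤ loadMap M N p G s2 c serv ρ r' i := by
  refine mul_le_mul_of_nonneg_left (Finset.sum_le_sum fun j hj => ?_) (one_div_pos.2 hc).le
  obtain rfl := (Finset.mem_filter.1 hj).2
  exact div_le_div_of_nonneg_right (h j) (log_one_add_gamma_serv_pos hp hG hs2 hserv hρ j).le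

lemma loadMap_serv_pos (hp : ∀ i, 0 < p i) (hG : ∀ k j, 0 ≤ G k j) (hs2 : 0 < s2) (hc : 0 < c)
    (hserv : ∀ j, 0 < G (serv j) j) (hρ : ∀ i, 0 ≤ ρ i) {r : Fin N → ℝ} (hr : ∀ j, 0 < r j)
    (j : Fin N) : 0 < loadMap M N p G s2 c serv ρ r (serv j) := by
  refine mul_pos (one_div_pos.2 hc) (Finset.sum_pos (fun k hk => ?_) ⟨j, by simp⟩)
  rw [← (Finset.mem_filter.1 hk).2]
  exact div_pos (hr k) (log_one_add_gamma_serv_pos hp hG hs2 hserv hρ k)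

lemma loadMap_eq_zero_of_forall_ne {i : Fin M} (hi : ∀ j, serv j ≠ i) (r : Fin N → ℝ) :
    loadMap M N p G s2 c serv ρ r i = 0 := by
  simp [loadMap, hi]

/-- Scaling the rates of each cell by a common factor scales the cell's load. -/
lemma loadMap_scale (t : Fin M → ℝ) (r : Fin N → ℝ) (i : Fin M) :
    loadMap M N p G s2 c serv ρ (fun j => t (serv j) * r j) i =
      t i * loadMap M N p G s2 c serv ρ r i := by
  rw [loadMap, loadMap, mul_left_comm]
  congr 1
  rw [Finset.mul_sum]
  refine Finset.sum_congr rfl fun j hj => ?_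
  rw [(Finset.mem_filter.1 hj).2, mul_div_assoc]

lemma continuousOn_loadMap (hp : ∀ i, 0 < p i) (hG : ∀ k j, 0 ≤ G k j) (hs2 : 0 < s2)
    (hserv : ∀ j, 0 < G (serv j) j) (r : Fin N → ℝ) :
    ContinuousOn (fun ρ => loadMap M N p G s2 c serv ρ r) {ρ | ∀ i, 0 ≤ ρ i} := by
  refine continuousOn_pi.2 fun i => continuousOn_const.mul (continuousOn_finsetSum _ fun j hj => ?_)
  obtain rfl := (Finset.mem_filter.1 hj).2
  have hgamma : ContinuousOn (fun ρ => gamma M N p G s2 ρ (serv j) j) {ρ | ∀ i, 0 ≤ ρ i} :=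
    continuousOn_const.div (by fun_prop)
      fun ρ hρ => (interference_add_noise_pos hp hG hs2 hρ _ j).ne'
  exact continuousOn_const.div
    ((continuousOn_const.add hgamma).log fun ρ hρ =>
      (add_pos one_pos (gamma_serv_pos hp hG hs2 hserv hρ j)).ne')
    fun ρ hρ => (log_one_add_gamma_serv_pos hp hG hs2 hserv hρ j).ne'

/-- A load vector is achieved by some rate vector above `rmin` iff it dominates the load that
`rmin` itself induces and vanishes on every base station without test points. -/
lemma exists_rate_loadMap_eq_iff (hp : ∀ i, 0 < p i) (hG : ∀ k j, 0 ≤ G k j) (hs2 : 0 < s2)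
    (hc : 0 < c) (hserv : ∀ j, 0 < G (serv j) j) (hρ : ∀ i, 0 ≤ ρ i) {rmin : Fin N → ℝ}
    (hrmin : ∀ j, 0 < rmin j) :
    (∃ r : Fin N → ℝ, (∀ j, rmin j ≤ r j) ∧ loadMap M N p G s2 c serv ρ r = ρ) ↔
      loadMap M N p G s2 c serv ρ rmin ≤ ρ ∧ ∀ i, (∀ j, serv j ≠ i) → ρ i = 0 := by
  constructor
  · rintro ⟨r, hr, heq⟩
    refine ⟨fun i => ?_, fun i hi => ?_⟩
    · exact (loadMap_mono_rate hp hG hs2 hc hserv hρ hr i).trans_eq (congrFun heq i)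
    · rw [← heq]
      exact loadMap_eq_zero_of_forall_ne hi r
  · rintro ⟨hle, hzero⟩
    refine ⟨fun j => ρ (serv j) / loadMap M N p G s2 c serv ρ rmin (serv j) * rmin j,
      fun j => ?_, funext fun i => ?_⟩
    · exact le_mul_of_one_le_left (hrmin j).le
        ((one_le_div (loadMap_serv_pos hp hG hs2 hc hserv hρ hrmin j)).2 (hle _))
    · rw [loadMap_scale (fun i => ρ i / loadMap M N p G s2 c serv ρ rmin i) rmin i]
      by_cases hi : ∀ j, serv j ≠ i
      · rw [loadMap_eq_zero_of_forall_ne hi, mul_zero, hzero i hi]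
      · push Not at hi
        obtain ⟨j, rfl⟩ := hi
        exact div_mul_cancel₀ _ (loadMap_serv_pos hp hG hs2 hc hserv hρ hrmin j).ne'

end

/-- The set of achievable cell-load vectors `Y` is compact. -/
theorem achievableLoads_isCompact
    {M N : ℕ} (hM : 0 < M) (hN : 0 < N)
    (p : Fin M → ℝ) (hp : ∀ i, 0 < p i)
    (G : Fin M → Fin N → ℝ) (hG : ∀ k j, 0 ≤ G k j)
    (s2 : ℝ) (hs2 : 0 < s2) (c : ℝ) (hc : 0 < c)
    (serv : Fin N → Fin M) (hserv : ∀ j, 0 < G (serv j) j)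
    (rmin : Fin N → ℝ) (hrmin : ∀ j, 0 < rmin j)
    (hXne : (FeasRegion M N p G s2 c serv rmin).Nonempty) :
    IsCompact {ρ : Fin M → ℝ | (∀ i, 0 ≤ ρ i) ∧ (∀ i, ρ i ≤ 1) ∧
      ∃ r ∈ FeasRegion M N p G s2 c serv rmin,
        loadMap M N p G s2 c serv ρ r = ρ} := by
  have hset : {ρ : Fin M → ℝ | (∀ i, 0 ≤ ρ i) ∧ (∀ i, ρ i ≤ 1) ∧
      ∃ r ∈ FeasRegion M N p G s2 c serv rmin, loadMap M N p G s2 c serv ρ r = ρ} =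
      {ρ ∈ Set.Icc (0 : Fin M → ℝ) 1 | loadMap M N p G s2 c serv ρ rmin ≤ ρ} ∩
        {ρ | ∀ i, (∀ j, serv j ≠ i) → ρ i = 0} := by
    ext ρ
    constructor
    · rintro ⟨h0, h1, r, hr, heq⟩
      obtain ⟨hle, hzero⟩ :=
        (exists_rate_loadMap_eq_iff hp hG hs2 hc hserv h0 hrmin).1 ⟨r, hr.2.1, heq⟩
      exact ⟨⟨⟨h0, h1⟩, hle⟩, hzero⟩
    · rintro ⟨⟨⟨h0, h1⟩, hle⟩, hzero⟩
      obtain ⟨r, hr, heq⟩ :=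
        (exists_rate_loadMap_eq_iff hp hG hs2 hc hserv h0 hrmin).2 ⟨hle, hzero⟩
      exact ⟨h0, h1, r, ⟨fun j => (hrmin j).trans_le (hr j), hr, ρ, h0, h1, heq⟩, heq⟩
  rw [hset]
  have hclosed : IsClosed {ρ ∈ Set.Icc (0 : Fin M → ℝ) 1 |
      loadMap M N p G s2 c serv ρ rmin ≤ ρ} :=
    isClosed_Icc.isClosed_le
      ((continuousOn_loadMap hp hG hs2 hserv rmin).mono fun ρ hρ => hρ.1) continuousOn_id
  have hclosed_zero : IsClosed {ρ : Fin M → ℝ | ∀ i, (∀ j, serv j ≠ i) → ρ i = 0} := by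
    simp only [Set.ofPred_forall]
    exact isClosed_iInter fun i => isClosed_iInter fun _ =>
      isClosed_eq (continuous_apply i) continuous_const
  exact isCompact_Icc.of_isClosed_subset (hclosed.inter hclosed_zero) fun ρ hρ => hρ.1.1
end

section
/- Assume X is closed under componentwise maxima (x, y ∈ X implies max(x, y) ∈ X) and that the data points x^1, …, x^K lie in X. Then every f ∈ F satisfies σ_l(x) ≤ f(x) ≤ σ_u(x) for all x ∈ X. -/
/-- Componentwise positive part `(x)₊ = max(x, 0)`. -/
def posPartVec {n : ℕ} (x : Fin n → ℝ) : Fin n → ℝ := fun i => max (x i) 0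

/-- Euclidean norm of a finitely-indexed real vector. -/
noncomputable def euclNorm {n : ℕ} (x : Fin n → ℝ) : ℝ :=
  Real.sqrt (∑ i, x i ^ 2)

/-- The lower envelope `σ_l(x) = max_k (ρ^k − L‖(x^k − x)₊‖)`. -/
noncomputable def sigLow {N K : ℕ} (xs : Fin K → Fin N → ℝ) (vals : Fin K → ℝ)
    (L : ℝ) (x : Fin N → ℝ) : ℝ :=
  ⨆ k : Fin K, (vals k - L * euclNorm (posPartVec (xs k - x)))

/-- The upper envelope `σ_u(x) = min_k (ρ^k + L‖(x − x^k)₊‖)`. -/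
noncomputable def sigUp {N K : ℕ} (xs : Fin K → Fin N → ℝ) (vals : Fin K → ℝ)
    (L : ℝ) (x : Fin N → ℝ) : ℝ :=
  ⨅ k : Fin K, (vals k + L * euclNorm (posPartVec (x - xs k)))

/-- The midpoint approximation `g = (σ_l + σ_u)/2`. -/
noncomputable def midApprox {N K : ℕ} (xs : Fin K → Fin N → ℝ) (vals : Fin K → ℝ)
    (L : ℝ) (x : Fin N → ℝ) : ℝ :=
  (sigLow xs vals L x + sigUp xs vals L x) / 2

/-- A function is monotone on a set (componentwise order). -/
def MonotoneOnSet {n : ℕ} (f : (Fin n → ℝ) → ℝ) (X : Set (Fin n → ℝ)) : Prop :=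
  ∀ x ∈ X, ∀ y ∈ X, (∀ i, x i ≤ y i) → f x ≤ f y

/-- A function is `L`-Lipschitz on a set with respect to the Euclidean norm. -/
def LipschitzOnSet {n : ℕ} (L : ℝ) (f : (Fin n → ℝ) → ℝ) (X : Set (Fin n → ℝ)) : Prop :=
  ∀ x ∈ X, ∀ y ∈ X, |f x - f y| ≤ L * euclNorm (x - y)

/-- Membership in the class `F` of LIMF interpolants of the data: monotone on `X`,
`L`-Lipschitz on `X` (Euclidean norm), and interpolating the data. -/
def MemF {N K : ℕ} (X : Set (Fin N → ℝ)) (xs : Fin K → Fin N → ℝ) (vals : Fin K → ℝ)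
    (L : ℝ) (f : (Fin N → ℝ) → ℝ) : Prop :=
  MonotoneOnSet f X ∧ LipschitzOnSet L f X ∧ ∀ k, f (xs k) = vals k

/-- Compatibility of the data with an `L`-Lipschitz monotone function. -/
def Compatible {N K : ℕ} (xs : Fin K → Fin N → ℝ) (vals : Fin K → ℝ) (L : ℝ) : Prop :=
  ∀ k j, vals k - vals j ≤ L * euclNorm (posPartVec (xs k - xs j))

/-- A monotone Lipschitz function on a set closed under componentwise maxima grows from `b` to `a`
by at most `L` times the Euclidean norm of the positive part of `a - b`. -/
theorem MonotoneOnSet.sub_le_euclNorm_posPartVec {n : ℕ} {L : ℝ} {X : Set (Fin n → ℝ)}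
    {f : (Fin n → ℝ) → ℝ} (hmono : MonotoneOnSet f X) (hlip : LipschitzOnSet L f X)
    {a b : Fin n → ℝ} (ha : a ∈ X) (hb : b ∈ X) (hab : (fun i => max (a i) (b i)) ∈ X) :
    f a - f b ≤ L * euclNorm (posPartVec (a - b)) := by
  have hpos : (fun i => max (a i) (b i)) - b = posPartVec (a - b) := by
    ext i
    simp [posPartVec, ← max_sub_sub_right]
  have hle := hmono a ha _ hab fun i => le_max_left _ _
  have hdist := (le_abs_self _).trans (hlip _ hab b hb)
  rw [hpos] at hdist
  linarith

/-- If `X` is closed under componentwise maxima and the data points lie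
in `X`, then every `f ∈ F` is squeezed between `σ_l` and `σ_u` on `X`. -/
theorem memF_between_envelopes
    {N K : ℕ} (hN : 0 < N) (hK : 0 < K)
    (L : ℝ) (hL : 0 ≤ L)
    (X : Set (Fin N → ℝ))
    (hXmax : ∀ x ∈ X, ∀ y ∈ X, (fun i => max (x i) (y i)) ∈ X)
    (xs : Fin K → Fin N → ℝ) (vals : Fin K → ℝ)
    (hxs : ∀ k, xs k ∈ X)
    (f : (Fin N → ℝ) → ℝ) (hf : MemF X xs vals L f) :
    ∀ x ∈ X, sigLow xs vals L x ≤ f x ∧ f x ≤ sigUp xs vals L x := by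
  obtain ⟨hmono, hlip, hval⟩ := hf
  have : Nonempty (Fin K) := ⟨⟨0, hK⟩⟩
  refine fun x hx => ⟨ciSup_le fun k => ?_, le_ciInf fun k => ?_⟩
  · have h := hmono.sub_le_euclNorm_posPartVec hlip (hxs k) hx (hXmax _ (hxs k) _ hx)
    rw [hval k] at h
    linarith
  · have h := hmono.sub_le_euclNorm_posPartVec hlip hx (hxs k) (hXmax _ hx _ (hxs k))
    rw [hval k] at h
    linarith
end

section
/- The functions σ_l and σ_u are monotone on ℝ^N (x ≤ y componentwise implies σ_l(x) ≤ σ_l(y) and σ_u(x) ≤ σ_u(y)) and are L-Lipschitz with respect to the Euclidean norm. -/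
theorem euclNorm_eq_norm {n : ℕ} (x : Fin n → ℝ) :
    euclNorm x = ‖(WithLp.toLp 2 x : EuclideanSpace ℝ (Fin n))‖ := by
  simp [euclNorm, EuclideanSpace.norm_eq]

theorem euclNorm_add_le {n : ℕ} (x y : Fin n → ℝ) :
    euclNorm (x + y) ≤ euclNorm x + euclNorm y := by
  simpa only [euclNorm_eq_norm, WithLp.toLp_add] using
    norm_add_le (WithLp.toLp 2 x : EuclideanSpace ℝ (Fin n)) (WithLp.toLp 2 y)

theorem euclNorm_sub_comm {n : ℕ} (x y : Fin n → ℝ) :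
    euclNorm (x - y) = euclNorm (y - x) := by
  simp only [euclNorm_eq_norm, WithLp.toLp_sub, norm_sub_rev]

theorem euclNorm_le_of_abs_le {n : ℕ} {x y : Fin n → ℝ} (h : ∀ i, |x i| ≤ |y i|) :
    euclNorm x ≤ euclNorm y :=
  Real.sqrt_le_sqrt (Finset.sum_le_sum fun i _ => sq_le_sq.mpr (h i))

theorem euclNorm_posPartVec_mono {n : ℕ} {x y : Fin n → ℝ} (h : ∀ i, x i ≤ y i) :
    euclNorm (posPartVec x) ≤ euclNorm (posPartVec y) :=
  euclNorm_le_of_abs_le fun i => abs_le_abs_of_nonneg (le_max_right _ _)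
    (max_le_max_right 0 (h i))

theorem euclNorm_posPartVec_le_add {n : ℕ} (x y : Fin n → ℝ) :
    euclNorm (posPartVec x) ≤ euclNorm (posPartVec y) + euclNorm (x - y) := by
  have h : euclNorm (posPartVec x - posPartVec y) ≤ euclNorm (x - y) :=
    euclNorm_le_of_abs_le fun i => abs_max_sub_max_le_abs (x i) (y i) 0
  have h_add := euclNorm_add_le (posPartVec y) (posPartVec x - posPartVec y)
  rw [add_sub_cancel] at h_add
  linarith

theorem ciSup_le_ciSup_add {ι : Type*} [Finite ι] [Nonempty ι] {f g : ι → ℝ} {c : ℝ}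
    (h : ∀ i, f i ≤ g i + c) : ⨆ i, f i ≤ (⨆ i, g i) + c :=
  ciSup_le fun i => (h i).trans
    (add_le_add_left (le_ciSup (Set.finite_range g).bddAbove i) c)

theorem ciInf_le_ciInf_add {ι : Type*} [Finite ι] [Nonempty ι] {f g : ι → ℝ} {c : ℝ}
    (h : ∀ i, f i ≤ g i + c) : ⨅ i, f i ≤ (⨅ i, g i) + c :=
  sub_le_iff_le_add.mp <| le_ciInf fun i => sub_le_iff_le_add.mpr <|
    (ciInf_le (Set.finite_range f).bddBelow i).trans (h i)

theorem sigLow_le_add {N K : ℕ} [Nonempty (Fin K)] {L : ℝ} (hL : 0 ≤ L)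
    (xs : Fin K → Fin N → ℝ) (vals : Fin K → ℝ) (x y : Fin N → ℝ) :
    sigLow xs vals L x ≤ sigLow xs vals L y + L * euclNorm (x - y) := by
  refine ciSup_le_ciSup_add fun k => ?_
  have h := mul_le_mul_of_nonneg_left (euclNorm_posPartVec_le_add (xs k - y) (xs k - x)) hL
  rw [sub_sub_sub_cancel_left] at h
  linarith

theorem sigUp_le_add {N K : ℕ} [Nonempty (Fin K)] {L : ℝ} (hL : 0 ≤ L)
    (xs : Fin K → Fin N → ℝ) (vals : Fin K → ℝ) (x y : Fin N → ℝ) :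
    sigUp xs vals L x ≤ sigUp xs vals L y + L * euclNorm (x - y) := by
  refine ciInf_le_ciInf_add fun k => ?_
  have h := mul_le_mul_of_nonneg_left (euclNorm_posPartVec_le_add (x - xs k) (y - xs k)) hL
  rw [sub_sub_sub_cancel_right] at h
  linarith

/-- `σ_l` and `σ_u` are monotone on `ℝ^N` and `L`-Lipschitz with
respect to the Euclidean norm. -/
theorem envelopes_monotone_lipschitz
    {N K : ℕ} (hN : 0 < N) (hK : 0 < K)
    (L : ℝ) (hL : 0 ≤ L)
    (xs : Fin K → Fin N → ℝ) (vals : Fin K → ℝ) :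
    (∀ x y : Fin N → ℝ, (∀ i, x i ≤ y i) →
      sigLow xs vals L x ≤ sigLow xs vals L y) ∧
    (∀ x y : Fin N → ℝ, (∀ i, x i ≤ y i) →
      sigUp xs vals L x ≤ sigUp xs vals L y) ∧
    (∀ x y : Fin N → ℝ,
      |sigLow xs vals L x - sigLow xs vals L y| ≤ L * euclNorm (x - y)) ∧
    (∀ x y : Fin N → ℝ,
      |sigUp xs vals L x - sigUp xs vals L y| ≤ L * euclNorm (x - y)) := by
  have : Nonempty (Fin K) := ⟨⟨0, hK⟩⟩
  refine ⟨fun x y hxy => ?_, fun x y hxy => ?_, fun x y => ?_, fun x y => ?_⟩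
  · refine ciSup_mono (Set.finite_range _).bddAbove fun k => ?_
    exact sub_le_sub_left (mul_le_mul_of_nonneg_left
      (euclNorm_posPartVec_mono fun i => sub_le_sub_left (hxy i) (xs k i)) hL) _
  · refine ciInf_mono (Set.finite_range _).bddBelow fun k => ?_
    exact add_le_add_right (mul_le_mul_of_nonneg_left
      (euclNorm_posPartVec_mono fun i => sub_le_sub_right (hxy i) (xs k i)) hL) _
  · have hxy := sigLow_le_add hL xs vals x y
    have hyx := sigLow_le_add hL xs vals y x
    rw [euclNorm_sub_comm] at hyx
    exact abs_sub_le_iff.mpr ⟨by linarith, by linarith⟩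
  · have hxy := sigUp_le_add hL xs vals x y
    have hyx := sigUp_le_add hL xs vals y x
    rw [euclNorm_sub_comm] at hyx
    exact abs_sub_le_iff.mpr ⟨by linarith, by linarith⟩
end

section
/- If the data is compatible, then for each k = 1, …, K one has σ_l(x^k) = σ_u(x^k) = ρ^k, and hence the midpoint approximation satisfies g(x^k) = ρ^k (it interpolates the data). -/
/-- The Euclidean norm of the positive part of `x - x` vanishes. -/
theorem euclNorm_posPartVec_sub_self {n : ℕ} (x : Fin n → ℝ) :
    euclNorm (posPartVec (x - x)) = 0 := by
  simp [euclNorm, posPartVec]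

/-- For compatible data the lower envelope interpolates. -/
theorem sigLow_eq_of_compatible {N K : ℕ} {xs : Fin K → Fin N → ℝ} {vals : Fin K → ℝ} {L : ℝ}
    (hcomp : Compatible xs vals L) (k : Fin K) : sigLow xs vals L (xs k) = vals k := by
  have : Nonempty (Fin K) := ⟨k⟩
  apply le_antisymm
  · exact ciSup_le fun j => by linarith [hcomp j k]
  · refine le_ciSup_of_le (Set.finite_range _).bddAbove k ?_
    simp [euclNorm_posPartVec_sub_self (xs k), -sub_self]

/-- For compatible data the upper envelope interpolates. -/
theorem sigUp_eq_of_compatible {N K : ℕ} {xs : Fin K → Fin N → ℝ} {vals : Fin K → ℝ} {L : ℝ}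
    (hcomp : Compatible xs vals L) (k : Fin K) : sigUp xs vals L (xs k) = vals k := by
  have : Nonempty (Fin K) := ⟨k⟩
  apply le_antisymm
  · refine ciInf_le_of_le (Set.finite_range _).bddBelow k ?_
    simp [euclNorm_posPartVec_sub_self (xs k), -sub_self]
  · exact le_ciInf fun j => by linarith [hcomp k j]

/-- If the data is compatible then `σ_l`, `σ_u`, and hence the midpoint
approximation `g`, interpolate the data. -/
theorem midApprox_interpolates
    {N K : ℕ} (hN : 0 < N) (hK : 0 < K)
    (L : ℝ) (hL : 0 ≤ L)
    (xs : Fin K → Fin N → ℝ) (vals : Fin K → ℝ)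
    (hcomp : Compatible xs vals L) :
    ∀ k, sigLow xs vals L (xs k) = vals k ∧ sigUp xs vals L (xs k) = vals k ∧
      midApprox xs vals L (xs k) = vals k := by
  intro k
  have hl := sigLow_eq_of_compatible hcomp k
  have hu := sigUp_eq_of_compatible hcomp k
  refine ⟨hl, hu, ?_⟩
  rw [midApprox, hl, hu, add_self_div_two]
end
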